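/- Let (x^{(N)}, B^{(N)}) = (x^i, B^i)_{i=1}^N be deterministic (or realized) vectors in (ℝ^d × C^η_T)^N with B^i_0 = 0, and let Γ satisfy the standing assumptions. Then for each N ≥ 1 there exists a unique vector (Y^1,…,Y^N) ∈ (C^{η∧γ}_T)^N solving the interacting particle system Y^i_t = x^i + (1/N) Σ_{j=1}^N ∫_0^t Γ_{dr}(Y^i_r − Y^j_r) + B^i_t for i = 1,…,N, where each integral is a nonlinear Young integral. -/

import Mathlib

open MeasureTheory Set

noncomputable section

abbrev Ed (d : ℕ) := EuclideanSpace ℝ (Fin d)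

def IsRiemannLimit {E : Type*} [NormedAddCommGroup E]
    (Ξ : ℝ → ℝ → E) (s t : ℝ) (I : E) : Prop :=
  ∀ ε > (0:ℝ), ∃ δ > (0:ℝ), ∀ n : ℕ, ∀ σ : Fin (n + 1) → ℝ,
    Monotone σ → σ 0 = s → σ (Fin.last n) = t →
    (∀ i : Fin n, σ i.succ - σ i.castSucc < δ) →
    ‖(∑ i : Fin n, Ξ (σ i.castSucc) (σ i.succ)) - I‖ < ε

/-- `Y` solves the `N`-particle interacting system
`Y^i_t = x^i + (1/N) Σ_j ∫_0^t Γ_{dr}(Y^i_r − Y^j_r) + B^i_t` on `[0,T]`,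
with `(η ∧ γ)`-Hölder particle paths and drifts given by nonlinear Young integrals. -/
def ParticleSol (d N : ℕ) (T γ η : ℝ) (Γ : ℝ → Ed d → Ed d)
    (x : Fin N → Ed d) (B Y : Fin N → ℝ → Ed d) : Prop :=
  ∀ i : Fin N,
    (∃ C : ℝ, ∀ u ∈ Icc (0:ℝ) T, ∀ v ∈ Icc (0:ℝ) T,
      ‖Y i v - Y i u‖ ≤ C * |v - u| ^ (min η γ)) ∧
    ∃ I : ℝ → Ed d, I 0 = 0 ∧
      (∀ s ∈ Icc (0:ℝ) T, ∀ t ∈ Icc (0:ℝ) T, s ≤ t →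
        IsRiemannLimit
          (fun u v => (N : ℝ)⁻¹ •
            ∑ j : Fin N, (Γ v (Y i u - Y j u) - Γ u (Y i u - Y j u))) s t (I t - I s)) ∧
      ∀ t ∈ Icc (0:ℝ) T, Y i t = x i + I t + B i t

lemma aux_split (β : ℝ) (hβ : 1 < β) (n p q : ℕ) (hn : p + q = n) (hp : 3 * p ≤ 2 * n)
    (hq : 3 * q ≤ 2 * n) :
    (p:ℝ) ^ β + (q:ℝ) ^ β ≤ (2/3 : ℝ) ^ (β - 1) * (n:ℝ) ^ β := by
  have key : ∀ p : ℕ, 3 * p ≤ 2 * n →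
      (p:ℝ) ^ β ≤ p * ((2/3 : ℝ) ^ (β - 1) * (n:ℝ) ^ (β-1)) := by
    intro p hp
    have hp' : (p:ℝ) ≤ 2/3 * n := by
      have : (3:ℝ) * p ≤ 2 * n := by exact_mod_cast hp
      linarith
    have e : (p:ℝ) ^ β = p * (p:ℝ) ^ (β - 1) := by
      have : (p:ℝ) ^ (1 + (β - 1)) = (p:ℝ) ^ (1:ℝ) * (p:ℝ) ^ (β-1) :=
        Real.rpow_add_of_nonneg (by positivity) (by norm_num) (by linarith)
      rw [Real.rpow_one] at this
      rw [← this]; congr 1; ring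
    rw [e, ← Real.mul_rpow (by norm_num) (by positivity)]
    gcongr
  have e : (n:ℝ) ^ β = n * (n:ℝ) ^ (β - 1) := by
    have : (n:ℝ) ^ (1 + (β - 1)) = (n:ℝ) ^ (1:ℝ) * (n:ℝ) ^ (β-1) :=
      Real.rpow_add_of_nonneg (by positivity) (by norm_num) (by linarith)
    rw [Real.rpow_one] at this
    rw [← this]; congr 1; ring
  have h1 := key p hp
  have h2 := key q hq
  have h3 : (n:ℝ) = p + q := by rw [← hn]; push_cast; ring
  rw [e]
  calc _ ≤ _ := add_le_add h1 h2
    _ = ((p:ℝ) + q) * ((2/3 : ℝ) ^ (β - 1) * (n:ℝ) ^ (β-1)) := by ring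
    _ = _ := by rw [← h3]; ring

lemma discrete_sewing (β lam D : ℝ) (hβ : 1 < β) (hlam : 1 ≤ lam) (hD : 0 ≤ D)
    (hc : lam * (2/3 : ℝ) ^ (β - 1) < 1) (M W : ℕ) (r : ℕ → ℕ → ℝ)
    (h1 : ∀ k, k + 1 ≤ M → r k (k+1) ≤ 0)
    (h2 : ∀ k l m, k < l → l < m → m ≤ M → m ≤ k + W →
      r k m ≤ lam * r k l + r l m + D * ((m:ℝ) - k) ^ β) :
    ∀ n, 1 ≤ n → ∀ k, n ≤ W → k + n ≤ M →
      r k (k+n) ≤ D / (1 - lam * (2/3 : ℝ) ^ (β - 1)) * (n:ℝ) ^ β := by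
  set c := (2/3 : ℝ) ^ (β - 1) with hcdef
  set K := D / (1 - lam * c) with hK
  have hK0 : 0 ≤ K := div_nonneg hD (by linarith)
  have hKD : K * (1 - lam * c) = D := div_mul_cancel₀ _ (by linarith)
  intro n
  induction n using Nat.strong_induction_on with
  | _ n ih =>
    intro hn k hW hM
    rcases Nat.lt_or_ge 1 n with hn2 | hn2
    · have hp1 : 1 ≤ n/2 := by omega
      have a1 := ih (n/2) (by omega) hp1 k (by omega) (by omega)
      have a2 := ih (n - n/2) (by omega) (by omega) (k + n/2) (by omega) (by omega)
      have e : k + n/2 + (n - n/2) = k + n := by omega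
      rw [e] at a2
      have a3 := h2 k (k+n/2) (k+n) (by omega) (by omega) hM (by omega)
      have e2 : ((k + n : ℕ) : ℝ) - k = n := by push_cast; ring
      rw [e2] at a3
      have a4 := aux_split β hβ n (n/2) (n - n/2) (by omega) (by omega) (by omega)
      rw [← hcdef] at a4
      have q0 : 0 ≤ (((n - n/2 : ℕ)) : ℝ) ^ β := by positivity
      calc r k (k+n) ≤ _ := a3
        _ ≤ lam * (K * ((n/2 : ℕ) : ℝ) ^ β) + lam * (K * ((n - n/2 : ℕ) : ℝ) ^ β) + D * (n:ℝ)^β := by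
            have : K * ((n - n/2 : ℕ) : ℝ) ^ β ≤ lam * (K * ((n - n/2 : ℕ) : ℝ) ^ β) :=
              le_mul_of_one_le_left (by positivity) hlam
            have : lam * r k (k+n/2) ≤ lam * (K * ((n/2 : ℕ) : ℝ) ^ β) := by gcongr
            linarith
        _ = lam * K * (((n/2 : ℕ) : ℝ) ^ β + ((n - n/2 : ℕ) : ℝ) ^ β) + D * (n:ℝ)^β := by ring
        _ ≤ lam * K * (c * (n:ℝ) ^ β) + D * (n:ℝ)^β := by gcongr
        _ = K * (n:ℝ)^β := by rw [← hKD]; ring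
    · have : n = 1 := by omega
      subst this
      exact (h1 k hM).trans (by positivity)

lemma sew_const_lt {β : ℝ} (hβ : 1 < β) : (2/3 : ℝ) ^ (β - 1) < 1 :=
  Real.rpow_lt_one (by norm_num) (by norm_num) (by linarith)

lemma sewing_bound {E : Type*} [NormedAddCommGroup E] (Ξ : ℝ → ℝ → E) (s t : ℝ) (hst : s ≤ t)
    (I : E) (hI : IsRiemannLimit Ξ s t I) (β D : ℝ) (hβ : 1 < β) (hD : 0 ≤ D)
    (h : ∀ u v w, s ≤ u → u ≤ v → v ≤ w → w ≤ t →
      ‖Ξ u w - Ξ u v - Ξ v w‖ ≤ D * (w - u) ^ β) :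
    ‖I - Ξ s t‖ ≤ D / (1 - (2/3 : ℝ) ^ (β - 1)) * (t - s) ^ β := by
  apply le_of_forall_pos_le_add
  intro ε hε
  obtain ⟨δ, hδ, H⟩ := hI ε hε
  obtain ⟨n, hn⟩ := exists_nat_gt ((t - s) / δ)
  have hn0 : (0:ℝ) < n := lt_of_le_of_lt (div_nonneg (by linarith) hδ.le) hn
  have hn1 : 1 ≤ n := by exact_mod_cast hn0
  set h' := (t - s) / n with hh'
  have hh0 : 0 ≤ h' := div_nonneg (by linarith) hn0.le
  have hnh : n * h' = t - s := by rw [hh']; field_simp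
  have hhδ : h' < δ := by
    rw [hh', div_lt_iff₀ hn0]
    rw [div_lt_iff₀ hδ] at hn
    linarith
  let P : ℕ → ℝ := fun i => s + i * h'
  have hPmono : Monotone P := by
    intro i j hij
    have : (i:ℝ) ≤ j := by exact_mod_cast hij
    simp only [P]; gcongr
  have hP0 : P 0 = s := by simp [P]
  have hPn : P n = t := by simp only [P]; linarith
  have H1 := H n (fun i => P i) (fun i j hij => hPmono hij) (by simpa using hP0) (by simpa using hPn)
    (by intro i; simp only [P, Fin.val_succ, Fin.val_castSucc]; push_cast; linarith)
  simp only [Fin.val_succ, Fin.val_castSucc] at H1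
  rw [Fin.sum_univ_eq_sum_range (fun i => Ξ (P i) (P (i+1))) n] at H1
  let r : ℕ → ℕ → ℝ := fun k l => ‖∑ i ∈ Finset.Ico k l, Ξ (P i) (P (i+1)) - Ξ (P k) (P l)‖
  have H2 := discrete_sewing β 1 (D * h' ^ β) hβ le_rfl (by positivity)
    (by rw [one_mul]; exact sew_const_lt hβ) n n r
    (by intro k _; simp [r])
    (by
      intro k l m hkl hlm hm _
      have e : ∑ i ∈ Finset.Ico k m, Ξ (P i) (P (i+1)) - Ξ (P k) (P m)
        = (∑ i ∈ Finset.Ico k l, Ξ (P i) (P (i+1)) - Ξ (P k) (P l))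
          + (∑ i ∈ Finset.Ico l m, Ξ (P i) (P (i+1)) - Ξ (P l) (P m))
          - (Ξ (P k) (P m) - Ξ (P k) (P l) - Ξ (P l) (P m)) := by
        rw [← Finset.sum_Ico_consecutive _ hkl.le hlm.le]; abel
      have b := h (P k) (P l) (P m) (hP0 ▸ hPmono (Nat.zero_le k)) (hPmono hkl.le) (hPmono hlm.le)
        (hPn ▸ hPmono hm)
      have e3 : P m - P k = h' * ((m:ℝ) - k) := by simp only [P]; ring
      have hmk : (0:ℝ) ≤ (m:ℝ) - k := by
        have : (k:ℝ) ≤ m := by exact_mod_cast (hkl.trans hlm).le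
        linarith
      rw [e3, Real.mul_rpow hh0 hmk] at b
      simp only [r]
      rw [e, one_mul]
      refine (norm_sub_le _ _).trans ?_
      have := norm_add_le (∑ i ∈ Finset.Ico k l, Ξ (P i) (P (i+1)) - Ξ (P k) (P l))
        (∑ i ∈ Finset.Ico l m, Ξ (P i) (P (i+1)) - Ξ (P l) (P m))
      linarith)
    n hn1 0 le_rfl (by omega)
  simp only [r, zero_add, hP0, hPn, one_mul] at H2
  rw [← Finset.range_eq_Ico] at H2
  have e5 : D * h' ^ β / (1 - (2/3 : ℝ) ^ (β - 1)) * (n:ℝ) ^ β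
      = D / (1 - (2/3 : ℝ) ^ (β - 1)) * (t - s) ^ β := by
    rw [← hnh, Real.mul_rpow hn0.le hh0]; ring
  rw [e5] at H2
  have e6 : I - Ξ s t = (∑ i ∈ Finset.range n, Ξ (P i) (P (i+1)) - Ξ s t)
     - (∑ i ∈ Finset.range n, Ξ (P i) (P (i+1)) - I) := by abel
  rw [e6]
  refine (norm_sub_le _ _).trans ?_
  linarith

lemma riemann_of_davie {E : Type*} [NormedAddCommGroup E] (Ξ : ℝ → ℝ → E) (J : ℝ → E)
    (s t : ℝ) (β K τ : ℝ) (hβ : 1 < β) (hK : 0 ≤ K) (hτ : 0 < τ)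
    (h : ∀ u v, s ≤ u → u ≤ v → v ≤ t → v - u < τ → ‖Ξ u v - (J v - J u)‖ ≤ K * (v - u) ^ β) :
    IsRiemannLimit Ξ s t (J t - J s) := by
  intro ε hε
  have hlim : Filter.Tendsto (fun δ : ℝ => K * δ ^ (β - 1) * (t - s)) (nhds 0) (nhds 0) := by
    have : ContinuousAt (fun δ : ℝ => K * δ ^ (β - 1) * (t - s)) 0 := by
      have := Real.continuousAt_rpow_const 0 (β - 1) (Or.inr (by linarith))
      fun_prop
    have h2 := this.tendsto
    rwa [Real.zero_rpow (by linarith), mul_zero, zero_mul] at h2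
  obtain ⟨δ0, hδ0, hδ⟩ := Metric.eventually_nhds_iff.1 (hlim.eventually (gt_mem_nhds hε))
  refine ⟨min τ (δ0/2), by positivity, ?_⟩
  intro n σ hσ hσ0 hσn hmesh
  have tel : ∑ i : Fin n, (J (σ i.succ) - J (σ i.castSucc)) = J t - J s := by
    rw [Finset.sum_sub_distrib]
    have a1 := Fin.sum_univ_succ (fun i => J (σ i))
    have a2 := Fin.sum_univ_castSucc (fun i => J (σ i))
    rw [hσ0] at a1
    rw [hσn] at a2
    rw [a1] at a2
    rw [sub_eq_sub_iff_add_eq_add, add_comm, a2, add_comm]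
  have tel2 : ∑ i : Fin n, (σ i.succ - σ i.castSucc) = t - s := by
    rw [Finset.sum_sub_distrib]
    have a1 := Fin.sum_univ_succ (fun i => (σ i))
    have a2 := Fin.sum_univ_castSucc (fun i => (σ i))
    rw [hσ0] at a1
    rw [hσn] at a2
    linarith
  rw [← tel, ← Finset.sum_sub_distrib]
  have hb : ∀ i : Fin n, ‖Ξ (σ i.castSucc) (σ i.succ) - (J (σ i.succ) - J (σ i.castSucc))‖
      ≤ K * (δ0/2) ^ (β - 1) * (σ i.succ - σ i.castSucc) := by
    intro i
    have m1 : σ i.castSucc ≤ σ i.succ := hσ (Fin.castSucc_lt_succ).le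
    have hm := hmesh i
    have := h (σ i.castSucc) (σ i.succ) (hσ0 ▸ hσ (Fin.zero_le _)) m1 (hσn ▸ hσ (Fin.le_last _))
      (hm.trans_le (min_le_left _ _))
    refine this.trans ?_
    set x := σ i.succ - σ i.castSucc with hx
    have hx0 : 0 ≤ x := by rw [hx]; linarith
    have e : x ^ β = x ^ (β - 1) * x := by
      have : x ^ ((β - 1) + 1) = x ^ (β - 1) * x ^ (1:ℝ) :=
        Real.rpow_add_of_nonneg hx0 (by linarith) (by norm_num)
      rw [Real.rpow_one] at this
      rw [← this]; congr 1; ring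
    rw [e, ← mul_assoc]
    have : x ≤ δ0/2 := (hm.trans_le (min_le_right _ _)).le
    have hb1 : 0 ≤ β - 1 := by linarith
    gcongr
  calc _ ≤ ∑ i : Fin n, K * (δ0/2) ^ (β - 1) * (σ i.succ - σ i.castSucc) :=
        norm_sum_le_of_le _ (fun i _ => hb i)
    _ = K * (δ0/2) ^ (β - 1) * (t - s) := by rw [← Finset.mul_sum, tel2]
    _ < ε := hδ (by rw [Real.dist_eq, sub_zero, abs_of_pos (by positivity)]; linarith)

lemma riemann_sub {E : Type*} [NormedAddCommGroup E] (Ξ Ξ' : ℝ → ℝ → E) (s t : ℝ) (I I' : E)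
    (h : IsRiemannLimit Ξ s t I) (h' : IsRiemannLimit Ξ' s t I') :
    IsRiemannLimit (fun u v => Ξ u v - Ξ' u v) s t (I - I') := by
  intro ε hε
  obtain ⟨δ, hδ, H⟩ := h (ε/2) (by positivity)
  obtain ⟨δ', hδ', H'⟩ := h' (ε/2) (by positivity)
  refine ⟨min δ δ', by positivity, ?_⟩
  intro n σ h1 h2 h3 h4
  have a := H n σ h1 h2 h3 (fun i => (h4 i).trans_le (min_le_left _ _))
  have b := H' n σ h1 h2 h3 (fun i => (h4 i).trans_le (min_le_right _ _))
  rw [Finset.sum_sub_distrib, sub_sub_sub_comm]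
  refine (norm_sub_le _ _).trans_lt ?_
  linarith

lemma riemann_pi {E : Type*} [NormedAddCommGroup E] {N : ℕ} (Ξ : ℝ → ℝ → Fin N → E) (s t : ℝ)
    (I : Fin N → E) (h : ∀ i, IsRiemannLimit (fun u v => Ξ u v i) s t (I i)) :
    IsRiemannLimit Ξ s t I := by
  intro ε hε
  choose δ hδ H using fun i => h i ε hε
  obtain ⟨d0, hd0, hd⟩ : ∃ d0 > 0, ∀ i, d0 ≤ δ i := by
    rcases isEmpty_or_nonempty (Fin N) with he | he
    · exact ⟨1, one_pos, fun i => (he.false i).elim⟩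
    · obtain ⟨i, hi⟩ := Finite.exists_min δ
      exact ⟨δ i, hδ i, hi⟩
  refine ⟨d0, hd0, ?_⟩
  intro n σ h1 h2 h3 h4
  rw [pi_norm_lt_iff hε]
  intro i
  have := H i n σ h1 h2 h3 (fun j => (h4 j).trans_le (hd i))
  simpa [Finset.sum_apply] using this

lemma riemann_comp {E : Type*} [NormedAddCommGroup E] {N : ℕ} (Ξ : ℝ → ℝ → Fin N → E) (s t : ℝ)
    (I : Fin N → E) (h : IsRiemannLimit Ξ s t I) (i : Fin N) :
    IsRiemannLimit (fun u v => Ξ u v i) s t (I i) := by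
  intro ε hε
  obtain ⟨δ, hδ, H⟩ := h ε hε
  refine ⟨δ, hδ, ?_⟩
  intro n σ h1 h2 h3 h4
  have := (norm_le_pi_norm _ i).trans_lt (H n σ h1 h2 h3 h4)
  simpa [Finset.sum_apply] using this

lemma rpow_split {x a b c : ℝ} (hx : 0 ≤ x) (ha : 0 ≤ a) (hb : 0 ≤ b) (h : a + b = c) :
    x ^ c = x ^ a * x ^ b := by
  rw [← h, Real.rpow_add_of_nonneg hx ha hb]

lemma unique_step {V : Type*} [NormedAddCommGroup V]
    (T γ α L H τ : ℝ) (hα : 0 < α) (hαγ : α ≤ γ) (hαγ1 : 1 < α + γ)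
    (hL : 0 ≤ L) (hH : 0 ≤ H) (A : ℝ → V → V)
    (hAb : ∀ s ∈ Icc (0:ℝ) T, ∀ t ∈ Icc (0:ℝ) T, ∀ y z : V,
      ‖(A t y - A s y) - (A t z - A s z)‖ ≤ L * |t - s| ^ γ * ‖y - z‖)
    (hAc : ∀ s ∈ Icc (0:ℝ) T, ∀ t ∈ Icc (0:ℝ) T, ∀ p p' q q' : V,
      ‖((A t p - A s p) - (A t p' - A s p')) - ((A t q - A s q) - (A t q' - A s q'))‖
        ≤ L * |t - s| ^ γ * (‖(p - p') - (q - q')‖ + ‖q - q'‖ * ‖p - q‖))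
    (Y Y' : ℝ → V)
    (hY : ∀ u ∈ Icc (0:ℝ) T, ∀ v ∈ Icc (0:ℝ) T, ‖Y v - Y u‖ ≤ H * |v - u| ^ α)
    (hR : ∀ s ∈ Icc (0:ℝ) T, ∀ t ∈ Icc (0:ℝ) T, s ≤ t →
      IsRiemannLimit (fun u v => (A v (Y u) - A u (Y u)) - (A v (Y' u) - A u (Y' u))) s t
        ((Y t - Y' t) - (Y s - Y' s)))
    (hτ0 : 0 < τ)
    (hτ : L * (1 + T ^ α * H) / (1 - (2/3 : ℝ) ^ (α + γ - 1)) * τ ^ γ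
      + L * T ^ (γ - α) * τ ^ α ≤ 1/2)
    (a b c : ℝ) (ha : 0 ≤ a) (hb : b ≤ T) (hab : b ≤ a + τ) (hZa : Y a = Y' a)
    (hc : 0 ≤ c)
    (hZ : ∀ s t, a ≤ s → s ≤ t → t ≤ b →
      ‖(Y t - Y' t) - (Y s - Y' s)‖ ≤ c * (t - s) ^ α) :
    ∀ s t, a ≤ s → s ≤ t → t ≤ b →
      ‖(Y t - Y' t) - (Y s - Y' s)‖ ≤ c / 2 * (t - s) ^ α := by
  intro s t has hst htb
  have hγ : 0 < γ := by linarith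
  have hT : 0 ≤ T := by linarith
  have hZv : ∀ v, a ≤ v → v ≤ b → ‖Y v - Y' v‖ ≤ c * (v - a) ^ α := by
    intro v h1 h2
    have := hZ a v le_rfl h1 h2
    rwa [hZa, sub_self, sub_zero] at this
  have S := sewing_bound _ s t hst _ (hR s ⟨by linarith, by linarith⟩ t ⟨by linarith, by linarith⟩ hst)
    (α + γ) (c * (L * (1 + T ^ α * H))) hαγ1 (by positivity) (by
      intro u v w hsu huv hvw hwt
      have h1 := hAc v ⟨by linarith, by linarith⟩ w ⟨by linarith, by linarith⟩ (Y u) (Y' u) (Y v) (Y' v)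
      have e : A w (Y u) - A u (Y u) - (A w (Y' u) - A u (Y' u)) -
          (A v (Y u) - A u (Y u) - (A v (Y' u) - A u (Y' u))) -
          (A w (Y v) - A v (Y v) - (A w (Y' v) - A v (Y' v)))
          = ((A w (Y u) - A v (Y u)) - (A w (Y' u) - A v (Y' u)))
            - ((A w (Y v) - A v (Y v)) - (A w (Y' v) - A v (Y' v))) := by abel
      rw [e]
      refine h1.trans ?_
      have b1 : ‖Y u - Y' u - (Y v - Y' v)‖ ≤ c * (w - u) ^ α := by
        rw [norm_sub_rev]
        refine (hZ u v (by linarith) huv (by linarith)).trans ?_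
        have : 0 ≤ v - u := by linarith
        gcongr
      have b2 : ‖Y v - Y' v‖ ≤ c * T ^ α := by
        refine (hZv v (by linarith) (by linarith)).trans ?_
        have : 0 ≤ v - a := by linarith
        gcongr
        linarith
      have b3 : ‖Y u - Y v‖ ≤ H * (w - u) ^ α := by
        rw [norm_sub_rev]
        refine (hY u ⟨by linarith, by linarith⟩ v ⟨by linarith, by linarith⟩).trans ?_
        rw [abs_of_nonneg (by linarith)]
        have : 0 ≤ v - u := by linarith
        gcongr
      have b4 : |w - v| ^ γ ≤ (w - u) ^ γ := by
        rw [abs_of_nonneg (by linarith)]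
        have : 0 ≤ w - v := by linarith
        gcongr
      have b5 : 0 ≤ (w - u) ^ γ := Real.rpow_nonneg (by linarith) _
      have b6 : 0 ≤ (w - u) ^ α := Real.rpow_nonneg (by linarith) _
      calc _ ≤ L * (w - u) ^ γ * (c * (w - u) ^ α + (c * T ^ α) * (H * (w - u) ^ α)) := by gcongr
        _ = _ := by
          rw [rpow_split (by linarith : 0 ≤ w - u) hα.le hγ.le rfl]; ring)
  have hX := hAb s ⟨by linarith, by linarith⟩ t ⟨by linarith, by linarith⟩ (Y s) (Y' s)
  have hts : 0 ≤ t - s := by linarith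
  rw [abs_of_nonneg hts] at hX
  have hX2 : L * (t - s) ^ γ * ‖Y s - Y' s‖ ≤ L * (T ^ (γ - α) * (t - s) ^ α) * (c * τ ^ α) := by
    have i1 : ‖Y s - Y' s‖ ≤ c * τ ^ α := by
      refine (hZv s has (by linarith)).trans ?_
      have : 0 ≤ s - a := by linarith
      gcongr
      linarith
    have i2 : (t - s) ^ γ ≤ T ^ (γ - α) * (t - s) ^ α := by
      rw [rpow_split hts (by linarith : 0 ≤ γ - α) hα.le (by ring)]
      have : 0 ≤ γ - α := by linarith
      gcongr
      linarith
    gcongr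
  have hcc := sew_const_lt hαγ1
  have hS2 : c * (L * (1 + T ^ α * H)) / (1 - (2/3 : ℝ) ^ (α + γ - 1)) * (t - s) ^ (α + γ)
      ≤ c * (L * (1 + T ^ α * H) / (1 - (2/3 : ℝ) ^ (α + γ - 1))) * ((t - s) ^ α * τ ^ γ) := by
    rw [rpow_split hts hα.le hγ.le rfl, mul_div_assoc]
    have : 0 ≤ 1 - (2/3 : ℝ) ^ (α + γ - 1) := by linarith
    gcongr
    linarith
  set Ξ := A t (Y s) - A s (Y s) - (A t (Y' s) - A s (Y' s)) with hΞ
  have fin : ‖(Y t - Y' t) - (Y s - Y' s)‖ ≤ ‖(Y t - Y' t) - (Y s - Y' s) - Ξ‖ + ‖Ξ‖ := by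
    have := norm_add_le ((Y t - Y' t) - (Y s - Y' s) - Ξ) Ξ
    rwa [sub_add_cancel] at this
  have hP : 0 ≤ c * (t - s) ^ α := by positivity
  have := mul_le_mul_of_nonneg_left hτ hP
  linarith

lemma unique_main {V : Type*} [NormedAddCommGroup V]
    (T γ α L H H' : ℝ) (hα : 0 < α) (hαγ : α ≤ γ) (hαγ1 : 1 < α + γ)
    (hL : 0 ≤ L) (hH : 0 ≤ H) (hH' : 0 ≤ H') (A : ℝ → V → V)
    (hAb : ∀ s ∈ Icc (0:ℝ) T, ∀ t ∈ Icc (0:ℝ) T, ∀ y z : V,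
      ‖(A t y - A s y) - (A t z - A s z)‖ ≤ L * |t - s| ^ γ * ‖y - z‖)
    (hAc : ∀ s ∈ Icc (0:ℝ) T, ∀ t ∈ Icc (0:ℝ) T, ∀ p p' q q' : V,
      ‖((A t p - A s p) - (A t p' - A s p')) - ((A t q - A s q) - (A t q' - A s q'))‖
        ≤ L * |t - s| ^ γ * (‖(p - p') - (q - q')‖ + ‖q - q'‖ * ‖p - q‖))
    (Y Y' : ℝ → V)
    (hY : ∀ u ∈ Icc (0:ℝ) T, ∀ v ∈ Icc (0:ℝ) T, ‖Y v - Y u‖ ≤ H * |v - u| ^ α)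
    (hY' : ∀ u ∈ Icc (0:ℝ) T, ∀ v ∈ Icc (0:ℝ) T, ‖Y' v - Y' u‖ ≤ H' * |v - u| ^ α)
    (hR : ∀ s ∈ Icc (0:ℝ) T, ∀ t ∈ Icc (0:ℝ) T, s ≤ t →
      IsRiemannLimit (fun u v => (A v (Y u) - A u (Y u)) - (A v (Y' u) - A u (Y' u))) s t
        ((Y t - Y' t) - (Y s - Y' s)))
    (h0 : Y 0 = Y' 0) : EqOn Y Y' (Icc 0 T) := by
  have hγ : 0 < γ := by linarith
  obtain ⟨τ, hτ0, hτ⟩ : ∃ τ > 0, L * (1 + T ^ α * H) / (1 - (2/3 : ℝ) ^ (α + γ - 1)) * τ ^ γ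
      + L * T ^ (γ - α) * τ ^ α ≤ 1/2 := by
    have : ContinuousAt (fun τ : ℝ => L * (1 + T ^ α * H) / (1 - (2/3 : ℝ) ^ (α + γ - 1)) * τ ^ γ
      + L * T ^ (γ - α) * τ ^ α) 0 := by
      have h1 := Real.continuousAt_rpow_const 0 γ (Or.inr hγ.le)
      have h2 := Real.continuousAt_rpow_const 0 α (Or.inr hα.le)
      fun_prop
    have h2 := this.tendsto
    rw [Real.zero_rpow hγ.ne', Real.zero_rpow hα.ne', mul_zero, mul_zero, add_zero] at h2
    obtain ⟨δ, hδ, h3⟩ := Metric.eventually_nhds_iff.1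
      (h2.eventually (gt_mem_nhds (by norm_num : (0:ℝ) < 1/2)))
    exact ⟨δ/2, by positivity, (h3 (by
      rw [Real.dist_eq, sub_zero, abs_of_pos (by positivity)]; linarith)).le⟩
  have step : ∀ a, 0 ≤ a → Y a = Y' a → ∀ t, a ≤ t → t ≤ T → t ≤ a + τ → Y t = Y' t := by
    intro a ha hZa t hat htT hta
    have iter : ∀ n : ℕ, ∀ s r, a ≤ s → s ≤ r → r ≤ t →
      ‖(Y r - Y' r) - (Y s - Y' s)‖ ≤ (H + H') / 2 ^ n * (r - s) ^ α := by
      intro n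
      induction n with
      | zero =>
        intro s r h1 h2 h3
        have i1 := hY s ⟨by linarith, by linarith⟩ r ⟨by linarith, by linarith⟩
        have i2 := hY' s ⟨by linarith, by linarith⟩ r ⟨by linarith, by linarith⟩
        rw [abs_of_nonneg (by linarith)] at i1 i2
        rw [sub_sub_sub_comm]
        refine (norm_sub_le _ _).trans ?_
        rw [pow_zero, div_one]
        linarith
      | succ n ih =>
        have := unique_step T γ α L H τ hα hαγ hαγ1 hL hH A hAb hAc Y Y' hY hR hτ0 hτ a t
          ((H + H') / 2 ^ n) ha htT hta hZa (by positivity) ih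
        intro s r h1 h2 h3
        have := this s r h1 h2 h3
        rwa [div_div, ← pow_succ] at this
    have lim : Filter.Tendsto (fun n : ℕ => (H + H') / 2 ^ n * (t - a) ^ α) Filter.atTop (nhds 0) := by
      have := (tendsto_pow_atTop_nhds_zero_of_lt_one (r := (1/2 : ℝ)) (by norm_num) (by norm_num))
      have := (this.const_mul (H + H')).mul_const ((t - a) ^ α)
      rw [mul_zero, zero_mul] at this
      refine this.congr (fun n => ?_)
      rw [one_div, inv_pow, div_eq_mul_inv]
    have := ge_of_tendsto' lim (fun n => iter n a t le_rfl hat le_rfl)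
    rw [hZa, sub_self, sub_zero] at this
    exact sub_eq_zero.1 (norm_le_zero_iff.1 this)
  have all : ∀ n : ℕ, ∀ t, 0 ≤ t → t ≤ T → t ≤ n * τ → Y t = Y' t := by
    intro n
    induction n with
    | zero =>
      intro t h1 h2 h3
      have : t = 0 := by simp at h3; linarith
      rw [this, h0]
    | succ n ih =>
      intro t h1 h2 h3
      rcases le_total t (n * τ) with h | h
      · exact ih t h1 h2 h
      · push_cast at h3
        exact step (n * τ) (by positivity) (ih _ (by positivity) (by linarith) le_rfl) t h h2
          (by linarith)
  intro t ht
  obtain ⟨n, hn⟩ := exists_nat_ge (t / τ)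
  exact all n t ht.1 ht.2 (by rwa [div_le_iff₀ hτ0] at hn)

def eulerSeq {V : Type*} [NormedAddCommGroup V] (A : ℝ → V → V) (B : ℝ → V) (x : V) (h : ℝ) :
    ℕ → V
  | 0 => x
  | k + 1 => eulerSeq A B x h k + (B (h * (k + 1 : ℕ)) - B (h * k))
      + (A (h * (k + 1 : ℕ)) (eulerSeq A B x h k) - A (h * k) (eulerSeq A B x h k))

lemma euler_bound {V : Type*} [NormedAddCommGroup V]
    (T γ α L CB : ℝ) (hα : 0 < α) (hαγ : α ≤ γ) (hαγ1 : 1 < α + γ)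
    (hL : 0 ≤ L) (hCB : 0 ≤ CB) (A : ℝ → V → V)
    (hAa : ∀ s ∈ Icc (0:ℝ) T, ∀ t ∈ Icc (0:ℝ) T, ∀ y : V,
      ‖A t y - A s y‖ ≤ L * |t - s| ^ γ)
    (hAb : ∀ s ∈ Icc (0:ℝ) T, ∀ t ∈ Icc (0:ℝ) T, ∀ y z : V,
      ‖(A t y - A s y) - (A t z - A s z)‖ ≤ L * |t - s| ^ γ * ‖y - z‖)
    (B : ℝ → V)
    (hB : ∀ u ∈ Icc (0:ℝ) T, ∀ v ∈ Icc (0:ℝ) T, ‖B v - B u‖ ≤ CB * |v - u| ^ α)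
    (x : V) (τ lam : ℝ) (hlam : 1 ≤ lam) (hlam2 : lam * (2/3 : ℝ) ^ (α + γ - 1) < 1)
    (hτ : L * τ ^ γ ≤ lam - 1)
    (h : ℝ) (hh : 0 < h) (M W : ℕ) (hM : h * M ≤ T) (hW : h * W ≤ τ) :
    ∀ k n : ℕ, n ≤ W → k + n ≤ M →
      ‖eulerSeq A B x h (k+n) - eulerSeq A B x h k - (B (h * (k + n : ℕ)) - B (h * k))
        - (A (h * (k+n : ℕ)) (eulerSeq A B x h k) - A (h * k) (eulerSeq A B x h k))‖
      ≤ L * (CB + L * T ^ (γ - α)) / (1 - lam * (2/3 : ℝ) ^ (α + γ - 1)) * (h * n) ^ (α + γ) := by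
  have hγ : 0 < γ := by linarith
  have hT : 0 ≤ T := le_trans (by positivity) hM
  set y := eulerSeq A B x h with hy
  set r : ℕ → ℕ → ℝ := fun k l => ‖y l - y k - (B (h * l) - B (h * k))
        - (A (h * l) (y k) - A (h * k) (y k))‖ with hr
  have hmem : ∀ k : ℕ, k ≤ M → h * k ∈ Icc (0:ℝ) T := by
    intro k hk
    have : (k:ℝ) ≤ M := by exact_mod_cast hk
    exact ⟨by positivity, le_trans (by gcongr) hM⟩
  have DS := discrete_sewing (α + γ) lam (L * (CB + L * T ^ (γ - α)) * h ^ (α + γ)) hαγ1 hlam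
    (by positivity) hlam2 M W r
    (by
      intro k _
      have : y (k+1) = y k + (B (h * (k + 1 : ℕ)) - B (h * k))
        + (A (h * (k + 1 : ℕ)) (y k) - A (h * k) (y k)) := by rw [hy]; rfl
      simp only [hr]
      rw [this]
      apply le_of_eq
      rw [norm_eq_zero]
      abel)
    (by
      intro k l m hkl hlm hm hmW
      have e : y m - y k - (B (h * m) - B (h * k)) - (A (h * m) (y k) - A (h * k) (y k))
        = (y l - y k - (B (h * l) - B (h * k)) - (A (h * l) (y k) - A (h * k) (y k)))
        + (y m - y l - (B (h * m) - B (h * l)) - (A (h * m) (y l) - A (h * l) (y l)))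
        + ((A (h * m) (y l) - A (h * l) (y l)) - (A (h * m) (y k) - A (h * l) (y k))) := by abel
      have b1 := hAb (h * l) (hmem l (by omega)) (h * m) (hmem m hm) (y l) (y k)
      have b2 : ‖y l - y k‖ ≤ r k l + CB * |h * l - h * k| ^ α + L * |h * l - h * k| ^ γ := by
        have i1 := hB (h * k) (hmem k (by omega)) (h * l) (hmem l (by omega))
        have i2 := hAa (h * k) (hmem k (by omega)) (h * l) (hmem l (by omega)) (y k)
        have e2 : y l - y k = (y l - y k - (B (h * l) - B (h * k)) - (A (h * l) (y k) - A (h * k) (y k)))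
          + (B (h * l) - B (h * k)) + (A (h * l) (y k) - A (h * k) (y k)) := by abel
        have := norm_add₃_le (a := (y l - y k - (B (h * l) - B (h * k)) - (A (h * l) (y k) - A (h * k) (y k))))
          (b := (B (h * l) - B (h * k))) (c := (A (h * l) (y k) - A (h * k) (y k)))
        rw [← e2] at this
        simp only [hr]
        linarith
      have hkl' : (k:ℝ) ≤ l := by exact_mod_cast hkl.le
      have hlm' : (l:ℝ) ≤ m := by exact_mod_cast hlm.le
      have hmW' : (m:ℝ) ≤ k + W := by exact_mod_cast hmW
      set X := h * ((m:ℝ) - k) with hX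
      have hX0 : 0 ≤ X := mul_nonneg hh.le (by linarith)
      have hXT : X ≤ T := by
        have := (hmem m hm).2
        have : 0 ≤ h * (k:ℝ) := by positivity
        rw [hX]; linarith
      have hXτ : X ≤ τ := by
        refine le_trans ?_ hW
        rw [hX]; gcongr; linarith
      have l1 : |h * l - h * k| ≤ X := by
        rw [← mul_sub, abs_of_nonneg (mul_nonneg hh.le (by linarith)), hX]; gcongr
      have l2 : |h * m - h * l| ≤ X := by
        rw [← mul_sub, abs_of_nonneg (mul_nonneg hh.le (by linarith)), hX]; gcongr
      have l3 : X ^ γ ≤ T ^ (γ - α) * X ^ α := by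
        rw [rpow_split hX0 (by linarith : 0 ≤ γ - α) hα.le (by ring)]
        have : 0 ≤ γ - α := by linarith
        gcongr
      have hr0 : 0 ≤ r k l := norm_nonneg _
      have b3 : ‖y l - y k‖ ≤ r k l + (CB + L * T ^ (γ - α)) * X ^ α := by
        have j1 : CB * |h * l - h * k| ^ α ≤ CB * X ^ α := by gcongr
        have j2 : L * |h * l - h * k| ^ γ ≤ L * (T ^ (γ - α) * X ^ α) := by
          refine le_trans ?_ (mul_le_mul_of_nonneg_left l3 hL)
          gcongr
        linarith
      have b4 : L * |h * m - h * l| ^ γ * ‖y l - y k‖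
          ≤ (lam - 1) * r k l + L * (CB + L * T ^ (γ - α)) * X ^ (α + γ) := by
        calc _ ≤ L * X ^ γ * (r k l + (CB + L * T ^ (γ - α)) * X ^ α) := by gcongr
          _ = L * X ^ γ * r k l + L * (CB + L * T ^ (γ - α)) * X ^ (α + γ) := by
            rw [rpow_split hX0 hα.le hγ.le rfl]; ring
          _ ≤ _ := by
            gcongr
            exact le_trans (by gcongr) hτ
      have hXp : X ^ (α + γ) = h ^ (α + γ) * ((m:ℝ) - k) ^ (α + γ) := by
        rw [hX, Real.mul_rpow hh.le (by linarith)]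
      rw [hXp] at b4
      have := norm_add₃_le (a := (y l - y k - (B (h * l) - B (h * k)) - (A (h * l) (y k) - A (h * k) (y k))))
        (b := (y m - y l - (B (h * m) - B (h * l)) - (A (h * m) (y l) - A (h * l) (y l))))
        (c := ((A (h * m) (y l) - A (h * l) (y l)) - (A (h * m) (y k) - A (h * l) (y k))))
      rw [← e] at this
      simp only [hr] at b4 ⊢
      linarith)
  intro k n hnW hkn
  rcases Nat.eq_zero_or_pos n with h0 | h0
  · subst h0
    have : (0:ℝ) ^ (α + γ) = 0 := Real.zero_rpow (by linarith)
    simp [this]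
  · have := DS n h0 k hnW hkn
    simp only [hr] at this
    refine this.trans (le_of_eq ?_)
    rw [Real.mul_rpow hh.le (by positivity)]
    ring

lemma euler_interp {V : Type*} [NormedAddCommGroup V]
    (T γ α L CB : ℝ) (hT : 0 < T) (hα : 0 < α) (hαγ : α ≤ γ) (hαγ1 : 1 < α + γ)
    (hL : 0 ≤ L) (hCB : 0 ≤ CB) (A : ℝ → V → V)
    (hAa : ∀ s ∈ Icc (0:ℝ) T, ∀ t ∈ Icc (0:ℝ) T, ∀ y : V,
      ‖A t y - A s y‖ ≤ L * |t - s| ^ γ)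
    (hAb : ∀ s ∈ Icc (0:ℝ) T, ∀ t ∈ Icc (0:ℝ) T, ∀ y z : V,
      ‖(A t y - A s y) - (A t z - A s z)‖ ≤ L * |t - s| ^ γ * ‖y - z‖)
    (B : ℝ → V)
    (hB : ∀ u ∈ Icc (0:ℝ) T, ∀ v ∈ Icc (0:ℝ) T, ‖B v - B u‖ ≤ CB * |v - u| ^ α)
    (x : V) : ∃ τ K R : ℝ, 0 < τ ∧ 0 ≤ K ∧ ∀ m : ℕ, ∃ Y : ℝ → V, ∃ g : ℝ → ℝ,
      Y 0 = x ∧ (∀ t ∈ Icc (0:ℝ) T, g t ∈ Icc (0:ℝ) T ∧ |g t - t| ≤ T / (m + 1) ∧ ‖Y t‖ ≤ R) ∧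
      ∀ s ∈ Icc (0:ℝ) T, ∀ t ∈ Icc (0:ℝ) T, s ≤ t → g t - g s ≤ τ →
        ‖Y t - Y s - (B (g t) - B (g s)) - (A (g t) (Y s) - A (g s) (Y s))‖
          ≤ K * (g t - g s) ^ (α + γ) := by
  have hγ : 0 < γ := by linarith
  have hc := sew_const_lt hαγ1
  set c := (2/3 : ℝ) ^ (α + γ - 1) with hcd
  have hc0 : 0 < c := by positivity
  set lam := 2 / (1 + c) with hlamd
  have hlam : 1 < lam := by rw [hlamd, lt_div_iff₀ (by positivity)]; linarith
  have hlam2 : lam * c < 1 := by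
    rw [hlamd, div_mul_eq_mul_div, div_lt_one (by positivity)]; linarith
  obtain ⟨p, hp0, hp⟩ : ∃ p : ℕ, 0 < p ∧ L * (T / p) ^ γ ≤ lam - 1 := by
    have h1 : Filter.Tendsto (fun n : ℕ => T / (n:ℝ)) Filter.atTop (nhds 0) :=
      tendsto_const_div_atTop_nhds_zero_nat T
    have h2 := (Real.continuousAt_rpow_const 0 γ (Or.inr hγ.le)).tendsto.comp h1
    have h3 := h2.const_mul L
    rw [Real.zero_rpow hγ.ne', mul_zero] at h3
    obtain ⟨p, hp⟩ := ((h3.eventually (gt_mem_nhds (by linarith : 0 < lam - 1))).and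
      (Filter.eventually_gt_atTop 0)).exists
    exact ⟨p, hp.2, hp.1.le⟩
  have hp0' : (0:ℝ) < p := by exact_mod_cast hp0
  set τ := T / p with hτd
  have hτ0 : 0 < τ := by positivity
  set K := L * (CB + L * T ^ (γ - α)) / (1 - lam * c) with hKd
  have hK : 0 ≤ K := div_nonneg (by positivity) (by linarith)
  set K1 := K * τ ^ (α + γ) + CB * τ ^ α + L * τ ^ γ with hK1
  have hK10 : 0 ≤ K1 := by positivity
  refine ⟨τ, K, ‖x‖ + (p + 1) * K1, hτ0, hK, ?_⟩
  intro m
  set W := m + 1 with hW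
  have hW0 : (0:ℝ) < W := by rw [hW]; positivity
  set h := τ / W with hhd
  have hh : 0 < h := by positivity
  have hhW : h * W = τ := by rw [hhd]; field_simp
  set M := p * W with hMd
  have hhM : h * M = T := by
    rw [hMd]; push_cast
    rw [mul_comm (p:ℝ), ← mul_assoc, hhW, hτd]; field_simp
  have EB := euler_bound T γ α L CB hα hαγ hαγ1 hL hCB A hAa hAb B hB x τ lam hlam.le hlam2 hp h hh
    M W hhM.le hhW.le
  set y := eulerSeq A B x h with hy
  have hmem : ∀ k : ℕ, k ≤ M → h * k ∈ Icc (0:ℝ) T := by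
    intro k hk
    have : (k:ℝ) ≤ M := by exact_mod_cast hk
    exact ⟨by positivity, le_trans (by gcongr) hhM.le⟩
  -- local bound
  have loc : ∀ k n : ℕ, n ≤ W → k + n ≤ M → ‖y (k+n) - y k‖ ≤ K1 := by
    intro k n hn hkn
    have b0 := EB k n hn hkn
    have i1 := hB (h * k) (hmem k (by omega)) (h * (k+n : ℕ)) (hmem _ hkn)
    have i2 := hAa (h * k) (hmem k (by omega)) (h * (k+n : ℕ)) (hmem _ hkn) (y k)
    have hhn : h * n ≤ τ := by
      rw [← hhW]; gcongr
    have e0 : |h * ((k + n : ℕ):ℝ) - h * k| = h * n := by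
      push_cast
      rw [← mul_sub, add_sub_cancel_left, abs_of_nonneg (by positivity)]
    rw [e0] at i1 i2
    have j0 : K * (h * n) ^ (α + γ) ≤ K * τ ^ (α + γ) := by gcongr
    have j1 : CB * (h * n) ^ α ≤ CB * τ ^ α := by gcongr
    have j2 : L * (h * n) ^ γ ≤ L * τ ^ γ := by gcongr
    have e2 : y (k+n) - y k = (y (k+n) - y k - (B (h * (k+n:ℕ)) - B (h * k)) - (A (h * (k+n:ℕ)) (y k) - A (h * k) (y k)))
          + (B (h * (k+n:ℕ)) - B (h * k)) + (A (h * (k+n:ℕ)) (y k) - A (h * k) (y k)) := by abel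
    have := norm_add₃_le (a := (y (k+n) - y k - (B (h * (k+n:ℕ)) - B (h * k)) - (A (h * (k+n:ℕ)) (y k) - A (h * k) (y k))))
          (b := (B (h * (k+n:ℕ)) - B (h * k))) (c := (A (h * (k+n:ℕ)) (y k) - A (h * k) (y k)))
    rw [← e2] at this
    linarith
  have hy0 : y 0 = x := rfl
  have glob : ∀ q k : ℕ, k ≤ M → k ≤ q * W → ‖y k - x‖ ≤ q * K1 := by
    intro q
    induction q with
    | zero =>
      intro k _ hk
      have : k = 0 := by simpa using hk
      subst this
      simp [hy0]
    | succ q ih =>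
      intro k hkM hk
      have i1 := ih (k - W) (by omega) (by rw [Nat.succ_mul] at hk; omega)
      have i2 := loc (k - W) (k - (k - W)) (by omega) (by omega)
      rw [show k - W + (k - (k - W)) = k by omega] at i2
      have := norm_add_le (y k - y (k - W)) (y (k - W) - x)
      rw [sub_add_sub_cancel] at this
      push_cast
      linarith
  refine ⟨fun t => y ⌊t / h⌋₊, fun t => h * (⌊t / h⌋₊ : ℕ), by simp [hy0], ?_, ?_⟩
  · intro t ht
    have hfl : ⌊t / h⌋₊ ≤ M := by
      apply Nat.floor_le_of_le
      rw [div_le_iff₀ hh]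
      linarith [ht.2]
    refine ⟨hmem _ hfl, ?_, ?_⟩
    · have a1 := Nat.floor_le (div_nonneg ht.1 hh.le)
      have a2 := Nat.lt_floor_add_one (t / h)
      rw [le_div_iff₀ hh] at a1
      rw [div_lt_iff₀ hh] at a2
      have hhT : h ≤ T / (m + 1) := by
        rw [hhd, hW]; push_cast
        gcongr
        rw [hτd]
        exact div_le_self hT.le (by exact_mod_cast hp0)
      rw [abs_le]
      constructor <;> linarith
    · have a := glob p _ hfl hfl
      have := norm_add_le (y ⌊t / h⌋₊ - x) x
      rw [sub_add_cancel] at this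
      simp only
      linarith
  · intro s hs t ht hst hg
    have hle : ⌊s / h⌋₊ ≤ ⌊t / h⌋₊ := Nat.floor_le_floor (by gcongr)
    have hfl : ⌊t / h⌋₊ ≤ M := by
      apply Nat.floor_le_of_le
      rw [div_le_iff₀ hh]
      linarith [ht.2]
    simp only at hg ⊢
    obtain ⟨n, hn⟩ := Nat.exists_eq_add_of_le hle
    rw [hn] at hg hfl ⊢
    have e : h * ((⌊s / h⌋₊ + n : ℕ):ℝ) - h * (⌊s / h⌋₊:ℕ) = h * n := by push_cast; ring
    rw [e] at hg ⊢
    refine EB _ n ?_ hfl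
    rw [← hhW] at hg
    have := le_of_mul_le_mul_left hg hh
    exact_mod_cast this

lemma exist_davie {V : Type*} [NormedAddCommGroup V] [ProperSpace V]
    (T γ α L CB : ℝ) (hT : 0 < T) (hα : 0 < α) (hαγ : α ≤ γ) (hαγ1 : 1 < α + γ)
    (hL : 0 ≤ L) (hCB : 0 ≤ CB) (A : ℝ → V → V)
    (hAa : ∀ s ∈ Icc (0:ℝ) T, ∀ t ∈ Icc (0:ℝ) T, ∀ y : V,
      ‖A t y - A s y‖ ≤ L * |t - s| ^ γ)
    (hAb : ∀ s ∈ Icc (0:ℝ) T, ∀ t ∈ Icc (0:ℝ) T, ∀ y z : V,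
      ‖(A t y - A s y) - (A t z - A s z)‖ ≤ L * |t - s| ^ γ * ‖y - z‖)
    (B : ℝ → V)
    (hB : ∀ u ∈ Icc (0:ℝ) T, ∀ v ∈ Icc (0:ℝ) T, ‖B v - B u‖ ≤ CB * |v - u| ^ α)
    (x : V) : ∃ Y : ℝ → V, ∃ τ K R : ℝ, 0 < τ ∧ 0 ≤ K ∧ Y 0 = x ∧
      (∀ t ∈ Icc (0:ℝ) T, ‖Y t‖ ≤ R) ∧
      ∀ s ∈ Icc (0:ℝ) T, ∀ t ∈ Icc (0:ℝ) T, s ≤ t → t - s < τ →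
        ‖Y t - Y s - (B t - B s) - (A t (Y s) - A s (Y s))‖ ≤ K * (t - s) ^ (α + γ) := by
  have hγ : 0 < γ := by linarith
  obtain ⟨τ, K, R, hτ, hK, H⟩ := euler_interp T γ α L CB hT hα hαγ hαγ1 hL hCB A hAa hAb B hB x
  choose Yn g hY0 hg hD using H
  let U : Ultrafilter ℕ := Filter.hyperfilter ℕ
  have hU : (U : Filter ℕ) ≤ Filter.atTop := by
    rw [← Nat.cofinite_eq_atTop]; exact Filter.hyperfilter_le_cofinite
  have hex : ∀ t : ℝ, ∃ z : V, t ∈ Icc (0:ℝ) T →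
      (‖z‖ ≤ R ∧ Filter.Tendsto (fun n => Yn n t) U (nhds z)) := by
    intro t
    by_cases ht : t ∈ Icc (0:ℝ) T
    · obtain ⟨z, hz, hz2⟩ := (isCompact_closedBall (0:V) R).ultrafilter_le_nhds
        (U.map (fun n => Yn n t)) (by
          rw [Filter.le_principal_iff]
          have : ∀ᶠ n in (U : Filter ℕ), Yn n t ∈ Metric.closedBall (0:V) R :=
            Filter.Eventually.of_forall (fun n => by simpa using (hg n t ht).2.2)
          exact this)
      exact ⟨z, fun _ => ⟨by simpa using hz, hz2⟩⟩
    · exact ⟨0, fun h => (ht h).elim⟩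
  choose Y hY using hex
  have hgt : ∀ t ∈ Icc (0:ℝ) T, Filter.Tendsto (fun n => |g n t - t|) U (nhds 0) := by
    intro t ht
    have h1 : Filter.Tendsto (fun n : ℕ => T / ((n:ℝ) + 1)) Filter.atTop (nhds 0) := by
      have := (tendsto_const_div_atTop_nhds_zero_nat T).comp (Filter.tendsto_add_atTop_nat 1)
      refine this.congr (fun n => ?_)
      simp
    exact squeeze_zero (fun n => abs_nonneg _) (fun n => (hg n t ht).2.1) (h1.mono_left hU)
  have hpow : ∀ t ∈ Icc (0:ℝ) T, ∀ C a : ℝ, 0 < a →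
      Filter.Tendsto (fun n => C * |g n t - t| ^ a) U (nhds 0) := by
    intro t ht C a ha
    have h2 := (Real.continuousAt_rpow_const 0 a (Or.inr ha.le)).tendsto.comp (hgt t ht)
    have h3 := h2.const_mul C
    rw [Real.zero_rpow ha.ne', mul_zero] at h3
    exact h3
  have hgt' : ∀ t ∈ Icc (0:ℝ) T, Filter.Tendsto (fun n => g n t) U (nhds t) := by
    intro t ht
    rw [tendsto_iff_dist_tendsto_zero]
    simpa [Real.dist_eq] using hgt t ht
  have hBt : ∀ t ∈ Icc (0:ℝ) T, Filter.Tendsto (fun n => B (g n t)) U (nhds (B t)) := by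
    intro t ht
    rw [tendsto_iff_norm_sub_tendsto_zero]
    exact squeeze_zero (fun n => norm_nonneg _) (fun n => hB t ht _ (hg n t ht).1)
      (hpow t ht CB α hα)
  have hAt : ∀ t ∈ Icc (0:ℝ) T, ∀ z : ℕ → V,
      Filter.Tendsto (fun n => A (g n t) (z n) - A t (z n)) U (nhds 0) := by
    intro t ht z
    rw [tendsto_zero_iff_norm_tendsto_zero]
    exact squeeze_zero (fun n => norm_nonneg _) (fun n => hAa t ht _ (hg n t ht).1 _)
      (hpow t ht L γ hγ)
  refine ⟨Y, τ, K, R, hτ, hK, ?_, fun t ht => (hY t ht).1, ?_⟩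
  · have h0 := (hY 0 ⟨le_rfl, hT.le⟩).2
    simp only [hY0] at h0
    exact tendsto_nhds_unique h0 tendsto_const_nhds
  · intro s hs t ht hst hts
    have hYs := (hY s hs).2
    have hYt := (hY t ht).2
    have hF : Filter.Tendsto (fun n => A t (Yn n s) - A s (Yn n s)) U
        (nhds (A t (Y s) - A s (Y s))) := by
      rw [tendsto_iff_norm_sub_tendsto_zero] at hYs ⊢
      refine squeeze_zero (fun n => norm_nonneg _) (fun n => hAb s hs t ht _ _) ?_
      simpa using hYs.const_mul (L * |t - s| ^ γ)
    have hF2 : Filter.Tendsto (fun n => A (g n t) (Yn n s) - A (g n s) (Yn n s)) U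
        (nhds (A t (Y s) - A s (Y s))) := by
      have := (hF.add (hAt t ht (fun n => Yn n s))).sub (hAt s hs (fun n => Yn n s))
      rw [add_zero, sub_zero] at this
      refine this.congr (fun n => ?_)
      abel
    have hl := (((hYt.sub hYs).sub ((hBt t ht).sub (hBt s hs))).sub hF2).norm
    have hd := (hgt' t ht).sub (hgt' s hs)
    have hr : Filter.Tendsto (fun n => K * (g n t - g n s) ^ (α + γ)) U
        (nhds (K * (t - s) ^ (α + γ))) :=
      ((Real.continuousAt_rpow_const (t - s) (α + γ) (Or.inr (by linarith))).tendsto.comp hd).const_mul K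
    refine le_of_tendsto_of_tendsto hl hr ?_
    filter_upwards [hd.eventually (gt_mem_nhds hts)] with n hn
    exact hD n s hs t ht hst hn.le

lemma exist_main {V : Type*} [NormedAddCommGroup V] [ProperSpace V]
    (T γ α L CB : ℝ) (hT : 0 < T) (hα : 0 < α) (hαγ : α ≤ γ) (hαγ1 : 1 < α + γ)
    (hL : 0 ≤ L) (hCB : 0 ≤ CB) (A : ℝ → V → V)
    (hAa : ∀ s ∈ Icc (0:ℝ) T, ∀ t ∈ Icc (0:ℝ) T, ∀ y : V,
      ‖A t y - A s y‖ ≤ L * |t - s| ^ γ)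
    (hAb : ∀ s ∈ Icc (0:ℝ) T, ∀ t ∈ Icc (0:ℝ) T, ∀ y z : V,
      ‖(A t y - A s y) - (A t z - A s z)‖ ≤ L * |t - s| ^ γ * ‖y - z‖)
    (B : ℝ → V)
    (hB : ∀ u ∈ Icc (0:ℝ) T, ∀ v ∈ Icc (0:ℝ) T, ‖B v - B u‖ ≤ CB * |v - u| ^ α)
    (x : V) : ∃ Y : ℝ → V, Y 0 = x ∧
      (∃ C : ℝ, 0 ≤ C ∧ ∀ u ∈ Icc (0:ℝ) T, ∀ v ∈ Icc (0:ℝ) T, ‖Y v - Y u‖ ≤ C * |v - u| ^ α) ∧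
      ∀ s ∈ Icc (0:ℝ) T, ∀ t ∈ Icc (0:ℝ) T, s ≤ t →
        IsRiemannLimit (fun u v => A v (Y u) - A u (Y u)) s t ((Y t - B t) - (Y s - B s)) := by
  have hγ : 0 < γ := by linarith
  obtain ⟨Y, τ, K, R, hτ, hK, hY0, hYR, hD⟩ :=
    exist_davie T γ α L CB hT hα hαγ hαγ1 hL hCB A hAa hAb B hB x
  have hR : 0 ≤ R := (norm_nonneg _).trans (hYR 0 ⟨le_rfl, hT.le⟩)
  refine ⟨Y, hY0, ?_, ?_⟩
  · have main : ∀ u ∈ Icc (0:ℝ) T, ∀ v ∈ Icc (0:ℝ) T, u ≤ v →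
        ‖Y v - Y u‖ ≤ (K * T ^ γ + CB + L * T ^ (γ - α) + 2 * R / τ ^ α) * (v - u) ^ α := by
      intro u hu v hv huv
      have hx0 : 0 ≤ v - u := by linarith
      have hxT : v - u ≤ T := by linarith [hu.1, hv.2]
      have hga : 0 ≤ γ - α := by linarith
      rcases lt_or_ge (v - u) τ with h | h
      · have b0 := hD u hu v hv huv h
        have i1 := hB u hu v hv
        have i2 := hAa u hu v hv (Y u)
        rw [abs_of_nonneg hx0] at i1 i2
        have j0 : K * (v - u) ^ (α + γ) ≤ K * T ^ γ * (v - u) ^ α := by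
          rw [rpow_split hx0 hα.le hγ.le rfl, mul_comm ((v - u) ^ α), mul_assoc]
          gcongr
        have j2 : L * (v - u) ^ γ ≤ L * T ^ (γ - α) * (v - u) ^ α := by
          rw [rpow_split hx0 hga hα.le (by ring), mul_assoc]
          gcongr
        have e2 : Y v - Y u = (Y v - Y u - (B v - B u) - (A v (Y u) - A u (Y u)))
          + (B v - B u) + (A v (Y u) - A u (Y u)) := by abel
        have := norm_add₃_le (a := (Y v - Y u - (B v - B u) - (A v (Y u) - A u (Y u))))
          (b := (B v - B u)) (c := (A v (Y u) - A u (Y u)))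
        rw [← e2] at this
        have : 0 ≤ 2 * R / τ ^ α * (v - u) ^ α := by positivity
        linarith
      · have a1 := norm_sub_le (Y v) (Y u)
        have a2 := hYR u hu
        have a3 := hYR v hv
        have a4 : 2 * R ≤ 2 * R / τ ^ α * (v - u) ^ α := by
          have hp : 0 < τ ^ α := by positivity
          rw [div_mul_eq_mul_div, le_div_iff₀ hp]
          gcongr
        have a5 : 0 ≤ (K * T ^ γ + CB + L * T ^ (γ - α)) * (v - u) ^ α := by positivity
        linarith
    refine ⟨K * T ^ γ + CB + L * T ^ (γ - α) + 2 * R / τ ^ α, by positivity, ?_⟩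
    intro u hu v hv
    rcases le_total u v with h | h
    · rw [abs_of_nonneg (by linarith)]
      exact main u hu v hv h
    · rw [abs_sub_comm, norm_sub_rev, abs_of_nonneg (by linarith)]
      exact main v hv u hu h
  · intro s hs t ht hst
    refine riemann_of_davie _ (fun r => Y r - B r) s t (α + γ) K τ hαγ1 hK hτ ?_
    intro u v h1 h2 h3 h4
    have := hD u ⟨by linarith [hs.1], by linarith [ht.2]⟩ v ⟨by linarith [hs.1], by linarith [ht.2]⟩ h2 h4
    rw [norm_sub_rev]
    have e : Y v - B v - (Y u - B u) - (A v (Y u) - A u (Y u))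
      = Y v - Y u - (B v - B u) - (A v (Y u) - A u (Y u)) := by abel
    simp only [e]
    exact this

lemma mean_le {E : Type*} [NormedAddCommGroup E] [NormedSpace ℝ E] {N : ℕ} (hN : 1 ≤ N)
    (f : Fin N → E) (b : ℝ) (h : ∀ j, ‖f j‖ ≤ b) : ‖(N:ℝ)⁻¹ • ∑ j, f j‖ ≤ b := by
  have hN' : (0:ℝ) < N := by exact_mod_cast hN
  rw [norm_smul, norm_inv, Real.norm_of_nonneg hN'.le, inv_mul_le_iff₀ hN']
  refine (norm_sum_le_of_le _ (fun j _ => h j)).trans ?_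
  simp

lemma second_order {E : Type*} [NormedAddCommGroup E] [NormedSpace ℝ E] (G : E → E)
    (hG : Differentiable ℝ G) (c : ℝ)
    (h1 : ∀ x y, ‖G x - G y‖ ≤ c * ‖x - y‖)
    (h2 : ∀ x y, ‖fderiv ℝ G x - fderiv ℝ G y‖ ≤ c * ‖x - y‖) (p p' q q' : E) :
    ‖(G p - G p') - (G q - G q')‖ ≤ c * (‖(p - p') - (q - q')‖ + ‖q - q'‖ * ‖p - q‖) := by
  set z := q - q' with hz
  have hd : ∀ y, HasFDerivAt (fun y => G y - G (y - z)) (fderiv ℝ G y - fderiv ℝ G (y - z)) y := by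
    intro y
    have a := (hG y).hasFDerivAt
    have b := (hG (y - z)).hasFDerivAt
    have b2 := b.comp y ((hasFDerivAt_id y).sub_const z)
    rw [ContinuousLinearMap.comp_id] at b2
    exact a.sub b2
  have m := Convex.norm_image_sub_le_of_norm_hasFDerivWithin_le (s := univ) (C := c * ‖z‖)
    (fun y _ => (hd y).hasFDerivWithinAt) (fun y _ => by
      have := h2 y (y - z)
      rwa [sub_sub_cancel] at this) convex_univ (mem_univ q) (mem_univ p)
  have l := h1 (p - z) p'
  have e : (G p - G p') - (G q - G q') = (G p - G (p - z) - (G q - G (q - z))) + (G (p - z) - G p') := by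
    rw [hz, sub_sub_cancel]; abel
  rw [e]
  refine (norm_add_le _ _).trans ?_
  have e2 : p - z - p' = p - p' - z := by abel
  rw [e2] at l
  linarith

def driftA (d N : ℕ) (Γ : ℝ → Ed d → Ed d) (t : ℝ) (y : Fin N → Ed d) : Fin N → Ed d :=
  fun i => (N : ℝ)⁻¹ • ∑ j : Fin N, Γ t (y i - y j)

lemma driftA_incr (d N : ℕ) (Γ : ℝ → Ed d → Ed d) (s t : ℝ) (y : Fin N → Ed d) (i : Fin N) :
    (driftA d N Γ t y - driftA d N Γ s y) i
      = (N : ℝ)⁻¹ • ∑ j : Fin N, (Γ t (y i - y j) - Γ s (y i - y j)) := by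
  simp only [driftA, Pi.sub_apply, ← smul_sub, ← Finset.sum_sub_distrib]

/-- **Well-posedness of the regularised interacting particle system.** -/
theorem stmt13 (d N : ℕ) (hN : 1 ≤ N) (T γ η CΓ : ℝ) (hT : 0 < T)
    (hγ : γ ∈ Ioo (1/2 : ℝ) 1) (hη : 0 < η) (hcond : 1 < min η γ + γ) (hCΓ : 0 ≤ CΓ)
    (Γ : ℝ → Ed d → Ed d)
    (hΓreg : ∀ t : ℝ, ContDiff ℝ 2 (Γ t))
    (hΓ1 : ∀ s ∈ Icc (0:ℝ) T, ∀ t ∈ Icc (0:ℝ) T, ∀ x : Ed d,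
      ‖Γ t x - Γ s x‖ + ‖fderiv ℝ (fun z => Γ t z - Γ s z) x‖ ≤ CΓ * |t - s| ^ γ)
    (hΓ2 : ∀ s ∈ Icc (0:ℝ) T, ∀ t ∈ Icc (0:ℝ) T, ∀ x y : Ed d,
      ‖(Γ t x - Γ s x) - (Γ t y - Γ s y)‖ ≤ CΓ * |t - s| ^ γ * ‖x - y‖)
    (hΓ3 : ∀ s ∈ Icc (0:ℝ) T, ∀ t ∈ Icc (0:ℝ) T, ∀ x y : Ed d,
      ‖fderiv ℝ (fun z => Γ t z - Γ s z) x - fderiv ℝ (fun z => Γ t z - Γ s z) y‖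
        ≤ CΓ * |t - s| ^ γ * ‖x - y‖)
    (x : Fin N → Ed d) (B : Fin N → ℝ → Ed d)
    (hB0 : ∀ i, B i 0 = 0)
    (hBreg : ∀ i, ∃ C : ℝ, ∀ u ∈ Icc (0:ℝ) T, ∀ v ∈ Icc (0:ℝ) T,
      ‖B i v - B i u‖ ≤ C * |v - u| ^ η) :
    ∃ Y : Fin N → ℝ → Ed d, ParticleSol d N T γ η Γ x B Y ∧
      ∀ Y' : Fin N → ℝ → Ed d, ParticleSol d N T γ η Γ x B Y' →
        ∀ i : Fin N, EqOn (Y i) (Y' i) (Icc (0:ℝ) T) := by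

  have hγ0 : 0 < γ := by have := hγ.1; linarith
  obtain ⟨α, hαd⟩ : ∃ α, α = min η γ := ⟨_, rfl⟩
  have hαγ : α ≤ γ := hαd ▸ min_le_right _ _
  have hαη : α ≤ η := hαd ▸ min_le_left _ _
  have hα : 0 < α := hαd ▸ lt_min hη hγ0
  rw [← hαd] at hcond
  set A := driftA d N Γ with hA
  have nn : ∀ s t : ℝ, 0 ≤ CΓ * |t - s| ^ γ := fun s t => by positivity
  have hAa : ∀ s ∈ Icc (0:ℝ) T, ∀ t ∈ Icc (0:ℝ) T, ∀ y : Fin N → Ed d,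
      ‖A t y - A s y‖ ≤ (4 * CΓ) * |t - s| ^ γ := by
    intro s hs t ht y
    have := nn s t
    rw [pi_norm_le_iff_of_nonneg (by positivity)]
    intro i
    rw [hA, driftA_incr]
    refine mean_le hN _ _ (fun j => ?_)
    have h1 := hΓ1 s hs t ht (y i - y j)
    have h2 := norm_nonneg (fderiv ℝ (fun z => Γ t z - Γ s z) (y i - y j))
    linarith
  have pair : ∀ (u : Fin N → Ed d) (i j : Fin N), ‖u i - u j‖ ≤ 2 * ‖u‖ := by
    intro u i j
    have h1 := norm_le_pi_norm u i
    have h2 := norm_le_pi_norm u j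
    have h3 := norm_sub_le (u i) (u j)
    linarith
  have hAb : ∀ s ∈ Icc (0:ℝ) T, ∀ t ∈ Icc (0:ℝ) T, ∀ y z : Fin N → Ed d,
      ‖(A t y - A s y) - (A t z - A s z)‖ ≤ (4 * CΓ) * |t - s| ^ γ * ‖y - z‖ := by
    intro s hs t ht y z
    rw [pi_norm_le_iff_of_nonneg (by positivity)]
    intro i
    rw [Pi.sub_apply, hA, driftA_incr, driftA_incr, ← smul_sub, ← Finset.sum_sub_distrib]
    refine mean_le hN _ _ (fun j => ?_)
    refine (hΓ2 s hs t ht _ _).trans ?_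
    have h1 := pair (y - z) i j
    have e : y i - y j - (z i - z j) = (y - z) i - (y - z) j := by
      simp only [Pi.sub_apply]; abel
    rw [e]
    have := mul_le_mul_of_nonneg_left h1 (nn s t)
    have := mul_nonneg (nn s t) (norm_nonneg (y - z))
    linarith
  have hAc : ∀ s ∈ Icc (0:ℝ) T, ∀ t ∈ Icc (0:ℝ) T, ∀ p p' q q' : Fin N → Ed d,
      ‖((A t p - A s p) - (A t p' - A s p')) - ((A t q - A s q) - (A t q' - A s q'))‖
        ≤ (4 * CΓ) * |t - s| ^ γ * (‖(p - p') - (q - q')‖ + ‖q - q'‖ * ‖p - q‖) := by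
    intro s hs t ht p p' q q'
    rw [pi_norm_le_iff_of_nonneg (by positivity)]
    intro i
    simp only [Pi.sub_apply (_ - _) (_ - _)]
    rw [hA, driftA_incr, driftA_incr, driftA_incr, driftA_incr, ← smul_sub, ← smul_sub, ← smul_sub,
      ← Finset.sum_sub_distrib, ← Finset.sum_sub_distrib, ← Finset.sum_sub_distrib]
    refine mean_le hN _ _ (fun j => ?_)
    have so := second_order (fun z => Γ t z - Γ s z)
      (((hΓreg t).differentiable (by norm_num)).sub ((hΓreg s).differentiable (by norm_num)))
      (CΓ * |t - s| ^ γ) (hΓ2 s hs t ht) (hΓ3 s hs t ht) (p i - p j) (p' i - p' j)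
      (q i - q j) (q' i - q' j)
    refine so.trans ?_
    have e1 : p i - p j - (p' i - p' j) - (q i - q j - (q' i - q' j))
      = (p - p' - (q - q')) i - (p - p' - (q - q')) j := by
      simp only [Pi.sub_apply]; abel
    have e2 : q i - q j - (q' i - q' j) = (q - q') i - (q - q') j := by
      simp only [Pi.sub_apply]; abel
    have e3 : p i - p j - (q i - q j) = (p - q) i - (p - q) j := by
      simp only [Pi.sub_apply]; abel
    rw [e1, e2, e3]
    have h1 := pair (p - p' - (q - q')) i j
    have h2 := pair (q - q') i j
    have h3 := pair (p - q) i j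
    have h4 := mul_le_mul h2 h3 (norm_nonneg _) (by positivity)
    have h0 := norm_nonneg (p - p' - (q - q'))
    calc _ ≤ CΓ * |t - s| ^ γ * (4 * (‖(p - p') - (q - q')‖ + ‖q - q'‖ * ‖p - q‖)) := by
          gcongr
          linarith
      _ = _ := by ring
  obtain ⟨CB, hCB, hB⟩ : ∃ CB : ℝ, 0 ≤ CB ∧ ∀ u ∈ Icc (0:ℝ) T, ∀ v ∈ Icc (0:ℝ) T,
      ‖(fun i => B i v) - (fun i => B i u)‖ ≤ CB * |v - u| ^ α := by
    choose C hC using hBreg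
    refine ⟨(∑ i, |C i|) * T ^ (η - α), by positivity, ?_⟩
    intro u hu v hv
    rw [pi_norm_le_iff_of_nonneg (by positivity)]
    intro i
    refine (hC i u hu v hv).trans ?_
    have hx : |v - u| ≤ T := by
      rw [abs_le]; constructor <;> linarith [hu.1, hu.2, hv.1, hv.2]
    have hea : 0 ≤ η - α := by linarith
    rw [rpow_split (abs_nonneg (v - u)) hea hα.le (by ring), mul_assoc]
    have : C i ≤ ∑ i, |C i| := (le_abs_self _).trans
      (Finset.single_le_sum (f := fun i => |C i|) (fun i _ => abs_nonneg _) (Finset.mem_univ i))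
    gcongr
  have conv : ∀ Y : Fin N → ℝ → Ed d, ParticleSol d N T γ η Γ x B Y →
      (∃ C : ℝ, 0 ≤ C ∧ ∀ u ∈ Icc (0:ℝ) T, ∀ v ∈ Icc (0:ℝ) T,
        ‖(fun i => Y i v) - (fun i => Y i u)‖ ≤ C * |v - u| ^ α) ∧
      (fun i => Y i 0) = x ∧
      ∀ s ∈ Icc (0:ℝ) T, ∀ t ∈ Icc (0:ℝ) T, s ≤ t →
        IsRiemannLimit (fun u v => A v (fun i => Y i u) - A u (fun i => Y i u)) s t
          (((fun i => Y i t) - (fun i => B i t)) - ((fun i => Y i s) - (fun i => B i s))) := by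
    intro Y hY
    refine ⟨?_, ?_, ?_⟩
    · choose C hC using fun i => (hY i).1
      refine ⟨∑ i, |C i|, by positivity, ?_⟩
      intro u hu v hv
      rw [pi_norm_le_iff_of_nonneg (by positivity)]
      intro i
      refine (hC i u hu v hv).trans ?_
      rw [← hαd]
      have : C i ≤ ∑ i, |C i| := (le_abs_self _).trans
        (Finset.single_le_sum (f := fun i => |C i|) (fun i _ => abs_nonneg _) (Finset.mem_univ i))
      gcongr
    · funext i
      obtain ⟨_, I, hI0, _, hI⟩ := hY i
      rw [hI 0 ⟨le_rfl, hT.le⟩, hI0, hB0]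
      simp
    · intro s hs t ht hst
      refine riemann_pi _ s t _ (fun i => ?_)
      obtain ⟨_, I, hI0, hR, hI⟩ := hY i
      simp only [hA, driftA_incr]
      have := hR s hs t ht hst
      have e : ((fun i => Y i t) - (fun i => B i t) - ((fun i => Y i s) - (fun i => B i s)) :
          Fin N → Ed d) i = I t - I s := by
        simp only [Pi.sub_apply, hI t ht, hI s hs]; abel
      rw [e]
      exact this
  obtain ⟨Y, hY0, ⟨C, hC0, hC⟩, hYR⟩ := exist_main T γ α (4 * CΓ) CB hT hα hαγ hcond (by positivity)
    hCB A hAa hAb (fun t i => B i t) hB x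
  have hsol : ParticleSol d N T γ η Γ x B (fun i t => Y t i) := by
    intro i
    refine ⟨⟨C, fun u hu v hv => ?_⟩, fun t => Y t i - x i - B i t, ?_, ?_, ?_⟩
    · rw [← hαd]
      exact (norm_le_pi_norm (Y v - Y u) i).trans (hC u hu v hv)
    · simp [hY0, hB0]
    · intro s hs t ht hst
      have := riemann_comp _ s t _ (hYR s hs t ht hst) i
      simp only [hA, driftA_incr] at this
      have e : (Y t - (fun i => B i t) - (Y s - (fun i => B i s)) : Fin N → Ed d) i
          = Y t i - x i - B i t - (Y s i - x i - B i s) := by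
        simp only [Pi.sub_apply]; abel
      rw [e] at this
      exact this
    · intro t _
      simp only
      abel
  refine ⟨fun i t => Y t i, hsol, ?_⟩
  intro Y' hY' i t ht
  obtain ⟨⟨H, hH, hY1⟩, hY2, hY3⟩ := conv _ hsol
  obtain ⟨⟨H', hH', hY1'⟩, hY2', hY3'⟩ := conv _ hY'
  have U := unique_main T γ α (4 * CΓ) H H' hα hαγ hcond (by positivity) hH hH' A hAb hAc
    (fun t i => Y t i) (fun t i => Y' i t) hY1 hY1' (by
      intro s hs t ht hst
      have := riemann_sub _ _ s t _ _ (hY3 s hs t ht hst) (hY3' s hs t ht hst)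
      have e : ∀ a b c a' c' b' : Fin N → Ed d,
        (a - b) - (c - b') - ((a' - b) - (c' - b')) = (a - a') - (c - c') := by
        intros; abel
      rw [e] at this
      exact this) (hY2.trans hY2'.symm)
  exact congrFun (U ht) i
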